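/- In the algebra A_N = k⟨x,y⟩/(yx - xy - x^N), for all i, j ≥ 0 one has x^i y^j = ∑_{t=0}^{j} (-i)_{N-1, j-t} · C(j,t) · x^{(j-t)(N-1)} y^t x^i. -/

import Mathlib

noncomputable section

/-- The relation `yx = xy + x^N` on the free algebra on two generators. -/
inductive AnRel (k : Type*) [Field k] (N : ℕ) :
    FreeAlgebra k (Fin 2) → FreeAlgebra k (Fin 2) → Prop
  | comm : AnRel k N (FreeAlgebra.ι k 1 * FreeAlgebra.ι k 0)
      (FreeAlgebra.ι k 0 * FreeAlgebra.ι k 1 + FreeAlgebra.ι k 0 ^ N)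

/-- The algebra `A_N = k⟨x,y⟩/(yx - xy - x^N)`. -/
abbrev AN (k : Type*) [Field k] (N : ℕ) := RingQuot (AnRel k N)

/-- The generator `x` of `A_N`. -/
def Ax (k : Type*) [Field k] (N : ℕ) : AN k N :=
  RingQuot.mkAlgHom k (AnRel k N) (FreeAlgebra.ι k 0)

/-- The generator `y` of `A_N`. -/
def Ay (k : Type*) [Field k] (N : ℕ) : AN k N :=
  RingQuot.mkAlgHom k (AnRel k N) (FreeAlgebra.ι k 1)

/-- The integer Pochhammer `m`-symbol `(a)_{m,s} = a(a+m)⋯(a+(s-1)m)`. -/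
def pochInt (a m : ℤ) (s : ℕ) : ℤ := ∏ r ∈ Finset.range s, (a + (r : ℤ) * m)

theorem aux_y_xpow {R : Type*} [Ring R] (x y : R) (n : ℕ) (h : y * x = x * y + x ^ (n + 1)) (m : ℕ) :
    y * x ^ m = x ^ m * y + (m : ℤ) • x ^ (m + n) := by
  induction m with
  | zero => simp
  | succ m ih =>
    have e : x ^ (m + n) * x = x ^ (m + 1 + n) := by rw [← pow_succ]; congr 1; omega
    have e2 : x ^ m * x ^ (n + 1) = x ^ (m + 1 + n) := by rw [← pow_add]; congr 1; omega
    calc y * x ^ (m + 1) = (y * x ^ m) * x := by rw [pow_succ, mul_assoc]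
      _ = x ^ m * (y * x) + (m : ℤ) • (x ^ (m + n) * x) := by
        rw [ih, add_mul, mul_assoc, smul_mul_assoc]
      _ = _ := by
        rw [h, e, mul_add, e2, ← mul_assoc, ← pow_succ]
        push_cast
        rw [add_smul, one_smul]
        abel

theorem aux_xpow_ypow {R : Type*} [Ring R] (x y : R) (n : ℕ) (h : y * x = x * y + x ^ (n + 1))
    (i j : ℕ) : x ^ i * y ^ j = (y - (i : ℤ) • x ^ n) ^ j * x ^ i := by
  induction j with
  | zero => simp
  | succ j ih =>
    have e : x ^ i * y = (y - (i : ℤ) • x ^ n) * x ^ i := by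
      rw [sub_mul, aux_y_xpow x y n h, smul_mul_assoc, ← pow_add, add_comm n i]
      abel
    rw [pow_succ, ← mul_assoc, ih, mul_assoc, e, ← mul_assoc, ← pow_succ]

theorem aux_expand {R : Type*} [Ring R] (x y : R) (n : ℕ) (h : y * x = x * y + x ^ (n + 1))
    (a : ℤ) (j : ℕ) : (y + a • x ^ n) ^ j =
      ∑ p ∈ Finset.HasAntidiagonal.antidiagonal j,
        j.choose p.1 • (pochInt a n p.2 • (x ^ (p.2 * n) * y ^ p.1)) := by
  induction j with
  | zero => simp [pochInt]
  | succ j ih =>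
    rw [Finset.sum_antidiagonal_choose_succ_nsmul
      (fun t s => pochInt a n s • (x ^ (s * n) * y ^ t)), pow_succ', ih, Finset.mul_sum,
      ← Finset.sum_add_distrib]
    refine Finset.sum_congr rfl fun p hp => ?_
    obtain ⟨t, s⟩ := p
    have hc : j.choose s = j.choose t := by
      rw [Finset.HasAntidiagonal.mem_antidiagonal] at hp
      exact Nat.choose_symm_of_eq_add (by simp at hp; omega)
    have hP : pochInt a n (s + 1) = pochInt a n s * (a + s * n) := by
      simp [pochInt, Finset.prod_range_succ]
    have e1 : y * (x ^ (s * n) * y ^ t) = x ^ (s * n) * y ^ (t + 1)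
        + ((s * n : ℕ) : ℤ) • (x ^ ((s + 1) * n) * y ^ t) := by
      rw [← mul_assoc, aux_y_xpow x y n h, add_mul, mul_assoc, ← pow_succ', smul_mul_assoc,
        Nat.succ_mul]
    have e2 : x ^ n * (x ^ (s * n) * y ^ t) = x ^ ((s + 1) * n) * y ^ t := by
      rw [← mul_assoc, ← pow_add, Nat.succ_mul, add_comm n]
    simp only [hc, hP]
    rw [← smul_add, mul_smul_comm, mul_smul_comm, add_mul, e1, smul_mul_assoc, e2]
    congr 1
    rw [mul_smul, ← smul_add, add_smul]
    push_cast
    congr 1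
    abel

theorem aux_rel (k : Type*) [Field k] (N : ℕ) :
    Ay k N * Ax k N = Ax k N * Ay k N + Ax k N ^ N := by
  have := RingQuot.mkAlgHom_rel k (AnRel.comm (k := k) (N := N))
  simpa [Ax, Ay] using this

/-- Reordering identity in `A_N`:
`x^i y^j = ∑_{t=0}^{j} (-i)_{N-1,j-t} C(j,t) x^{(j-t)(N-1)} y^t x^i`. -/
theorem xi_yj_reorder (k : Type*) [Field k] [CharZero k] (N : ℕ) (hN : 1 ≤ N) (i j : ℕ) :
    Ax k N ^ i * Ay k N ^ j
      = ∑ t ∈ Finset.range (j + 1),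
          (pochInt (-(i : ℤ)) ((N : ℤ) - 1) (j - t) * (j.choose t : ℤ)) •
            (Ax k N ^ ((j - t) * (N - 1)) * Ay k N ^ t * Ax k N ^ i) := by
  obtain ⟨n, rfl⟩ : ∃ n, N = n + 1 := ⟨N - 1, by omega⟩
  have h := aux_rel k (n + 1)
  have e : Ay k (n + 1) - (i : ℤ) • Ax k (n + 1) ^ n
      = Ay k (n + 1) + (-(i : ℤ)) • Ax k (n + 1) ^ n := by
    rw [neg_smul, sub_eq_add_neg]
  rw [aux_xpow_ypow _ _ n h, e, aux_expand _ _ n h, Finset.sum_mul,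
    Finset.Nat.sum_antidiagonal_eq_sum_range_succ_mk]
  refine Finset.sum_congr rfl fun t _ => ?_
  have hn : ((n + 1 : ℕ) : ℤ) - 1 = n := by push_cast; ring
  rw [hn, Nat.add_sub_cancel, mul_comm (pochInt _ _ _), mul_smul, smul_mul_assoc, smul_mul_assoc,
    natCast_zsmul]
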